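/- arXiv:2207.13203 — 2 statements merged into one kernel-verified Lean document; each statement's English description precedes it below -/
import Mathlib

section
/- Let $n \geq 1$ and $\epsilon_2, \epsilon_3 \geq 0$ be integers. Consider the abelian group $G$ generated by symbols $\bar{Z}$, $\bar{E}_1,\dots,\bar{E}_{\epsilon_2}$, $\bar{F}_{\infty,1},\dots,\bar{F}_{\infty,\epsilon_3}$, $\bar{F}_{0,1},\dots,\bar{F}_{0,\epsilon_3}$, $V$, subject to the relations $\bar{Z} = 2\bar{E}_i$ for all $i$, $\bar{Z} = 3\bar{F}_{0,i}$ for all $i$, $\bar{F}_{\infty,i} = 2\bar{F}_{0,i}$ for all $i$, and $V = n\bar{Z} - \sum_{i=1}^{\epsilon_2}\bar{E}_i - 2\sum_{i=1}^{\epsilon_3}\bar{F}_{0,i}$. Then $G \cong \mathbb{Z} \oplus (\mathbb{Z}/2\mathbb{Z})^{\max(\epsilon_2 - 1, 0)} \oplus (\mathbb{Z}/3\mathbb{Z})^{\max(\epsilon_3 - 1, 0)}$. -/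
open FreeAbelianGroup

/-- Generators: one `Z̄`, the `Ē i` (`i < ε₂`), the `F̄_{∞,i}` and `F̄_{0,i}`
(`i < ε₃`), and one `V`. -/
abbrev Gen5 (e2 e3 : ℕ) : Type := Unit ⊕ (Fin e2 ⊕ (Fin e3 ⊕ (Fin e3 ⊕ Unit)))

def Zg (e2 e3 : ℕ) : FreeAbelianGroup (Gen5 e2 e3) := of (Sum.inl ())
def Eg (e2 e3 : ℕ) (i : Fin e2) : FreeAbelianGroup (Gen5 e2 e3) := of (Sum.inr (Sum.inl i))
def Finfg (e2 e3 : ℕ) (i : Fin e3) : FreeAbelianGroup (Gen5 e2 e3) :=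
  of (Sum.inr (Sum.inr (Sum.inl i)))
def F0g (e2 e3 : ℕ) (i : Fin e3) : FreeAbelianGroup (Gen5 e2 e3) :=
  of (Sum.inr (Sum.inr (Sum.inr (Sum.inl i))))
def Vg (e2 e3 : ℕ) : FreeAbelianGroup (Gen5 e2 e3) :=
  of (Sum.inr (Sum.inr (Sum.inr (Sum.inr ()))))

/-- The relations `Z̄ = 2Ē i`, `Z̄ = 3F̄_{0,i}`, `F̄_{∞,i} = 2F̄_{0,i}` and
`V = nZ̄ - ∑ Ē i - 2∑ F̄_{0,i}`. -/
def rels5 (n e2 e3 : ℕ) : Set (FreeAbelianGroup (Gen5 e2 e3)) :=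
  { x | (∃ i, x = Zg e2 e3 - (2 : ℤ) • Eg e2 e3 i) ∨
        (∃ i, x = Zg e2 e3 - (3 : ℤ) • F0g e2 e3 i) ∨
        (∃ i, x = Finfg e2 e3 i - (2 : ℤ) • F0g e2 e3 i) ∨
        x = Vg e2 e3 -
          ((n : ℤ) • Zg e2 e3 - (∑ i, Eg e2 e3 i) - (2 : ℤ) • ∑ i, F0g e2 e3 i) }

/-- The multiplier of the free part: a family of `e` elements with the common multiple `p • x i = z`
generates `z` from one element with multiplier `p`, unless the family is empty. -/
def familyMultiplier (p e : ℕ) : ℤ := if e = 0 then 1 else p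

/-- The torsion coordinates of the `i`-th element of a family of `e` elements, relative to the
element of index `0`. -/
def torsionCoord (p e : ℕ) (i : Fin e) : Fin (e - 1) → ZMod p :=
  fun j => if (j : ℕ) + 1 = i then 1 else 0

lemma familyMultiplier_of_fin (p : ℕ) {e : ℕ} (i : Fin e) : familyMultiplier p e = p :=
  if_neg (Nat.ne_zero_of_lt i.isLt)

lemma isCoprime_familyMultiplier {p q : ℕ} (h : p.Coprime q) (d e : ℕ) :
    IsCoprime (familyMultiplier p d) (familyMultiplier q e) := by
  unfold familyMultiplier
  split_ifs
  · exact isCoprime_one_left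
  · exact isCoprime_one_left
  · exact isCoprime_one_right
  · exact Nat.isCoprime_iff_coprime.mpr h

lemma nsmul_torsionCoord (p e : ℕ) (i : Fin e) : (p : ℤ) • torsionCoord p e i = 0 := by
  ext j
  simp

lemma torsionCoord_zero (p e : ℕ) : torsionCoord p (e + 1) 0 = 0 := by
  ext j
  simp [torsionCoord]

lemma torsionCoord_succ (p e : ℕ) (j : Fin e) :
    torsionCoord p (e + 1) j.succ = Pi.single (M := fun _ : Fin e => ZMod p) j 1 := by
  ext k
  change (if (k : ℕ) + 1 = (j.succ : ℕ) then (1 : ZMod p) else 0) = _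
  simp [Pi.single_apply, Fin.ext_iff]

/-- The homomorphism from `(ℤ/p)^e` determined by `e` elements killed by `p`. -/
lemma exists_addMonoidHom_pi_zmod {Q : Type*} [AddCommGroup Q] (p e : ℕ) (y : Fin e → Q)
    (hy : ∀ j, (p : ℤ) • y j = 0) :
    ∃ T : (Fin e → ZMod p) →+ Q, ∀ j, T (Pi.single j 1) = y j := by
  let f (j : Fin e) : ZMod p →+ Q :=
    ZMod.lift p ⟨zmultiplesHom Q (y j), by simpa using hy j⟩
  have hf (j : Fin e) : f j 1 = y j := by
    have := ZMod.lift_coe p ⟨zmultiplesHom Q (y j), by simpa using hy j⟩ 1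
    simpa [f] using this
  refine ⟨∑ j, (f j).comp (Pi.evalAddMonoidHom _ j), fun j => ?_⟩
  rw [AddMonoidHom.finsetSum_apply, Finset.sum_eq_single j]
  · simp [hf]
  · intro k _ hk
    simp [hk]
  · simp

/-- A family with common `p`-multiple `z` splits into a free part and a `p`-torsion part,
compatibly with a given homomorphism `φ`. -/
lemma exists_family_splitting {Q A : Type*} [AddCommGroup Q] [AddCommGroup A] (p e : ℕ)
    (z : Q) (y : Fin e → Q) (hy : ∀ i, (p : ℤ) • y i = z) (φ : Q →+ A) (x : A)
    (ι : (Fin (e - 1) → ZMod p) →+ A) (hz : φ z = familyMultiplier p e • x)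
    (hφ : ∀ i, φ (y i) = x + ι (torsionCoord p e i)) :
    ∃ (w : Q) (T : (Fin (e - 1) → ZMod p) →+ Q), familyMultiplier p e • w = z ∧
      (∀ i, y i = w + T (torsionCoord p e i)) ∧ φ w = x ∧ φ.comp T = ι := by
  cases e with
  | zero =>
    refine ⟨z, 0, by simp [familyMultiplier], fun i => i.elim0, by simpa [familyMultiplier] using hz,
      ?_⟩
    refine AddMonoidHom.ext fun v => ?_
    obtain rfl : v = 0 := funext fun i => Fin.elim0 i
    exact (map_zero φ).trans (map_zero ι).symm
  | succ e =>
    obtain ⟨T, hT⟩ := exists_addMonoidHom_pi_zmod p e (fun j => y j.succ - y 0)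
      (fun j => by rw [smul_sub, hy, hy, sub_self])
    have hx : φ (y 0) = x := by rw [hφ, torsionCoord_zero, map_zero, add_zero]
    refine ⟨y 0, T, by rw [familyMultiplier_of_fin p (0 : Fin (e + 1)), hy], fun i => ?_, hx, ?_⟩
    · refine Fin.cases ?_ (fun j => ?_) i
      · rw [torsionCoord_zero]
        exact (add_eq_left.mpr (map_zero T)).symm
      · rw [torsionCoord_succ]
        exact ((congrArg (y 0 + ·) (hT j)).trans (add_sub_cancel _ _)).symm
    · refine AddMonoidHom.functions_ext' (I := Fin e) (M := fun _ => ZMod p) _ _ _ fun j => ?_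
      refine (AddMonoidHom.cancel_right (f := Int.castAddHom (ZMod p))
        (ZMod.intCast_surjective (n := p))).mp ?_
      refine AddMonoidHom.ext_int ?_
      have h := hφ j.succ
      rw [torsionCoord_succ] at h
      have h1 : φ (T (Pi.single j 1)) = ι (Pi.single (M := fun _ : Fin e => ZMod p) j 1) := by
        rw [hT, map_sub, h, hx, add_sub_cancel_left]
      simpa using h1

/-- The abelian group presented by these generators and relations is
`ℤ ⊕ (ℤ/2)^{max(ε₂-1,0)} ⊕ (ℤ/3)^{max(ε₃-1,0)}`. -/
theorem statement_5 (n e2 e3 : ℕ) (hn : 1 ≤ n) :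
    Nonempty ((FreeAbelianGroup (Gen5 e2 e3) ⧸ AddSubgroup.closure (rels5 n e2 e3)) ≃+
      ℤ × (Fin (e2 - 1) → ZMod 2) × (Fin (e3 - 1) → ZMod 3)) := by
  set a := familyMultiplier 2 e2 with ha
  set b := familyMultiplier 3 e3 with hb
  let N := AddSubgroup.closure (rels5 n e2 e3)
  let π := QuotientAddGroup.mk' N
  let zA : ℤ × (Fin (e2 - 1) → ZMod 2) × (Fin (e3 - 1) → ZMod 3) := (a * b, 0, 0)
  let eA (i : Fin e2) : ℤ × (Fin (e2 - 1) → ZMod 2) × (Fin (e3 - 1) → ZMod 3) :=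
    (b, torsionCoord 2 e2 i, 0)
  let fA (i : Fin e3) : ℤ × (Fin (e2 - 1) → ZMod 2) × (Fin (e3 - 1) → ZMod 3) :=
    (a, 0, torsionCoord 3 e3 i)
  let val : Gen5 e2 e3 →
      ℤ × (Fin (e2 - 1) → ZMod 2) × (Fin (e3 - 1) → ZMod 3) :=
    Sum.elim (fun _ => zA) <| Sum.elim eA <|
    Sum.elim (fun i => (2 : ℤ) • fA i) <| Sum.elim fA
    fun _ => (n : ℤ) • zA - (∑ i, eA i) - (2 : ℤ) • ∑ i, fA i
  let Φ := FreeAbelianGroup.lift val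
  have ΦZ : Φ (Zg e2 e3) = zA := lift_apply_of _ _
  have ΦE i : Φ (Eg e2 e3 i) = eA i := lift_apply_of _ _
  have ΦF i : Φ (F0g e2 e3 i) = fA i := lift_apply_of _ _
  have ΦG i : Φ (Finfg e2 e3 i) = (2 : ℤ) • fA i := lift_apply_of _ _
  have ΦV : Φ (Vg e2 e3) = (n : ℤ) • zA - (∑ i, eA i) - (2 : ℤ) • ∑ i, fA i :=
    lift_apply_of _ _
  have hker : N ≤ Φ.ker := by
    refine (AddSubgroup.closure_le _).mpr ?_
    rintro x (⟨i, rfl⟩ | ⟨i, rfl⟩ | ⟨i, rfl⟩ | rfl) <;>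
      rw [SetLike.mem_coe, AddMonoidHom.mem_ker]
    · have := nsmul_torsionCoord 2 e2 i
      have h2 := familyMultiplier_of_fin 2 i
      rw [map_sub, map_zsmul, ΦZ, ΦE, sub_eq_zero]
      refine Prod.ext ?_ (Prod.ext this.symm (smul_zero (2 : ℤ)).symm)
      change a * b = 2 * b
      rw [ha, h2]
      rfl
    · have := nsmul_torsionCoord 3 e3 i
      have h3 := familyMultiplier_of_fin 3 i
      rw [map_sub, map_zsmul, ΦZ, ΦF, sub_eq_zero]
      refine Prod.ext ?_ (Prod.ext (smul_zero (3 : ℤ)).symm this.symm)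
      change a * b = 3 * a
      rw [hb, h3, mul_comm]
      rfl
    · rw [map_sub, map_zsmul, ΦG, ΦF, sub_self]
    · simp only [map_sub, map_zsmul, map_sum, ΦV, ΦZ, ΦE, ΦF, sub_self]
  let φ : FreeAbelianGroup (Gen5 e2 e3) ⧸ N →+
      ℤ × (Fin (e2 - 1) → ZMod 2) × (Fin (e3 - 1) → ZMod 3) := QuotientAddGroup.lift N Φ hker
  have hφ x : φ (π x) = Φ x := rfl
  have hrel {x y} (h : x - y ∈ rels5 n e2 e3) : π x = π y := by
    rw [← sub_eq_zero, ← map_sub]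
    exact (QuotientAddGroup.eq_zero_iff _).mpr (AddSubgroup.subset_closure h)
  have hE i : π (Zg e2 e3) = (2 : ℤ) • π (Eg e2 e3 i) := by
    rw [← map_zsmul]
    exact hrel (.inl ⟨i, rfl⟩)
  have hF i : π (Zg e2 e3) = (3 : ℤ) • π (F0g e2 e3 i) := by
    rw [← map_zsmul]
    exact hrel (.inr (.inl ⟨i, rfl⟩))
  have hG i : π (Finfg e2 e3 i) = (2 : ℤ) • π (F0g e2 e3 i) := by
    rw [← map_zsmul]
    exact hrel (.inr (.inr (.inl ⟨i, rfl⟩)))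
  have hV : π (Vg e2 e3) = (n : ℤ) • π (Zg e2 e3) - (∑ i, π (Eg e2 e3 i)) -
      (2 : ℤ) • ∑ i, π (F0g e2 e3 i) := by
    simp only [← map_zsmul, ← map_sum, ← map_sub]
    exact hrel (.inr (.inr (.inr rfl)))
  obtain ⟨w, T, hw, hET, φw, φT⟩ := exists_family_splitting 2 e2 (π (Zg e2 e3))
    (fun i => π (Eg e2 e3 i)) (fun i => (hE i).symm) φ (b, 0, 0)
    ((AddMonoidHom.inr _ _).comp (AddMonoidHom.inl _ _))
    (by rw [hφ, ΦZ]; simp [zA, ← ha]) (fun i => by rw [hφ, ΦE]; simp [eA])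
  obtain ⟨u, S, hu, hFS, φu, φS⟩ := exists_family_splitting 3 e3 (π (Zg e2 e3))
    (fun i => π (F0g e2 e3 i)) (fun i => (hF i).symm) φ (a, 0, 0)
    ((AddMonoidHom.inr _ _).comp (AddMonoidHom.inr _ _))
    (by rw [hφ, ΦZ]; simp [zA, ← hb, mul_comm]) (fun i => by rw [hφ, ΦF]; simp [fA])
  rw [← ha] at hw
  rw [← hb] at hu
  obtain ⟨r, s, hrs⟩ : IsCoprime a b := isCoprime_familyMultiplier (by norm_num) e2 e3
  let g := s • w + r • u
  have hbg : b • g = w := by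
    calc b • g = (s * b) • w + r • (b • u) := by simp only [g]; module
      _ = (r * a + s * b) • w := by rw [hu, ← hw]; module
      _ = w := by rw [hrs, one_smul]
  have hag : a • g = u := by
    calc a • g = s • (a • w) + (r * a) • u := by simp only [g]; module
      _ = (r * a + s * b) • u := by rw [hw, ← hu]; module
      _ = u := by rw [hrs, one_smul]
  let ψ : ℤ × (Fin (e2 - 1) → ZMod 2) × (Fin (e3 - 1) → ZMod 3) →+
      FreeAbelianGroup (Gen5 e2 e3) ⧸ N := (zmultiplesHom _ g).coprod (T.coprod S)
  have hψ (k : ℤ) (t) (v) : ψ (k, t, v) = k • g + (T t + S v) := rfl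
  have ψZ : ψ zA = π (Zg e2 e3) := by
    rw [hψ, map_zero, map_zero, add_zero, add_zero, mul_smul, hbg, hw]
  have ψE i : ψ (eA i) = π (Eg e2 e3 i) := by
    rw [hψ, map_zero, add_zero, hbg]
    exact (hET i).symm
  have ψF i : ψ (fA i) = π (F0g e2 e3 i) := by
    rw [hψ, map_zero, zero_add, hag]
    exact (hFS i).symm
  have hψφ : ψ.comp φ = AddMonoidHom.id _ := by
    refine QuotientAddGroup.addMonoidHom_ext _ (FreeAbelianGroup.lift_ext _ _ fun x => ?_)
    change ψ (φ (π (of x))) = π (of x)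
    rcases x with ⟨⟩ | i | i | i | ⟨⟩
    · exact (congrArg ψ ΦZ).trans ψZ
    · exact (congrArg ψ (ΦE i)).trans (ψE i)
    · refine (congrArg ψ (ΦG i)).trans ?_
      rw [map_zsmul, ψF]
      exact (hG i).symm
    · exact (congrArg ψ (ΦF i)).trans (ψF i)
    · refine (congrArg ψ ΦV).trans ?_
      simp only [map_sub, map_zsmul, map_sum, ψZ, ψE, ψF]
      exact hV.symm
  have hφg : φ g = (1, 0, 0) := by
    rw [map_add, map_zsmul, map_zsmul, φw, φu, ← hrs]
    simp [add_comm]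
  have hφψ : φ.comp ψ = AddMonoidHom.id _ := by
    ext1 ⟨k, t, v⟩
    have hT := DFunLike.congr_fun φT t
    have hS := DFunLike.congr_fun φS v
    rw [AddMonoidHom.comp_apply] at hT hS ⊢
    rw [hψ, map_add, map_add, map_zsmul, hφg, hT, hS]
    simp
  exact ⟨φ.toAddEquiv ψ hψφ hφψ⟩
end

section
/- Let $n \geq 1$, $m \geq 1$, and let $\Gamma$ be the multigraph with two vertices $Z_0, Z_\infty$ joined by $n$ parallel edges, together with an extra vertex $v_0$ joined by one edge to each of $Z_0$ and $Z_\infty$. Let $C = \{Z_0, Z_\infty\}$, let $\Delta: \mathbb{Z}[C] \to \mathbb{Z}[C]^{\deg=0}$ be the Laplacian of the subgraph on $C$ (so $\Delta(Z_0) = n((Z_0)-(Z_\infty))$, $\Delta(Z_\infty) = n((Z_\infty)-(Z_0))$), let $I = \{x_\infty, x_0\}$ with $\theta: I \to C$, $\theta(x_\infty) = Z_\infty$, $\theta(x_0) = Z_0$, and let $\theta^*: \mathbb{Z}[C] \to \mathbb{Z}^I/\mathrm{diag}(\mathbb{Z})$ be the induced map. Then $\mathrm{coker}\left((\Delta, \theta^*):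 \mathbb{Z}[C] \to \mathbb{Z}[C]^{\deg=0} \oplus \mathbb{Z}^I/\mathrm{diag}(\mathbb{Z})\right) \cong \mathbb{Z}$, and the composite $\mathbb{Z}^I/\mathrm{diag}(\mathbb{Z}) \to \mathrm{coker} \cong \mathbb{Z}$ is injective with image $n\mathbb{Z}$. -/
/-- The degree map `ℤ[C] → ℤ` for the two components `C = {Z₀, Z_∞}`. -/
def deg14 : (Fin 2 → ℤ) →ₗ[ℤ] ℤ := ∑ v : Fin 2, LinearMap.proj v

/-- `ℤ[C]^{deg=0}`. -/
def K14 : Submodule ℤ (Fin 2 → ℤ) := LinearMap.ker deg14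

/-- The Laplacian of the subgraph on `C = {Z₀, Z_∞}` with `n` parallel edges. -/
def lap14 (n : ℕ) : (Fin 2 → ℤ) →ₗ[ℤ] (Fin 2 → ℤ) :=
  (Matrix.of fun i j : Fin 2 => if i = j then (n : ℤ) else -(n : ℤ)).mulVecLin

/-- The constant vectors `diag(ℤ) ⊆ ℤ^I`, `I = {x₀, x_∞}`. -/
def diag14 : Submodule ℤ (Fin 2 → ℤ) :=
  LinearMap.range (LinearMap.pi (fun _ : Fin 2 => LinearMap.id (R := ℤ) (M := ℤ)))

/-- `ℤ^I/diag(ℤ)`. -/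
abbrev Q14 : Type := (Fin 2 → ℤ) ⧸ diag14

/-- The map `(Δ, θ^*) : ℤ[C] → ℤ[C] × ℤ^I/diag(ℤ)`; here `θ : I → C` identifies
`x₀ ↦ Z₀`, `x_∞ ↦ Z_∞` (both indexed by `Fin 2`), so `θ^*` is the quotient map. -/
def F14 (n : ℕ) : (Fin 2 → ℤ) →ₗ[ℤ] ((Fin 2 → ℤ) × Q14) :=
  LinearMap.prod (lap14 n) (Submodule.mkQ diag14)

/-- The target `ℤ[C]^{deg=0} ⊕ ℤ^I/diag(ℤ)` as a submodule of `ℤ[C] × ℤ^I/diag(ℤ)`. -/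
def P14 : Submodule ℤ ((Fin 2 → ℤ) × Q14) := K14.prod ⊤

/-- The cokernel of `(Δ, θ^*) : ℤ[C] → ℤ[C]^{deg=0} ⊕ ℤ^I/diag(ℤ)`. -/
abbrev Coker14 (n : ℕ) : Type :=
  ↥P14 ⧸ Submodule.comap P14.subtype (LinearMap.range (F14 n))

/-- The inclusion `ℤ^I/diag(ℤ) → ℤ[C]^{deg=0} ⊕ ℤ^I/diag(ℤ)`, `q ↦ (0, q)`. -/
def j14 : Q14 →ₗ[ℤ] ↥P14 :=
  LinearMap.codRestrict P14 (LinearMap.inr ℤ (Fin 2 → ℤ) Q14)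
    (fun _q => Submodule.mem_prod.mpr ⟨K14.zero_mem, Submodule.mem_top⟩)

theorem mem_K14_iff (a : Fin 2 → ℤ) : a ∈ K14 ↔ a 0 + a 1 = 0 := by
  simp [K14, deg14, LinearMap.mem_ker]

theorem mem_diag14_iff (b : Fin 2 → ℤ) : b ∈ diag14 ↔ b 0 = b 1 := by
  constructor
  · rintro ⟨c, rfl⟩
    rfl
  · intro h
    refine ⟨b 0, funext fun i => ?_⟩
    fin_cases i
    · rfl
    · exact h

theorem lap14_apply (n : ℕ) (x : Fin 2 → ℤ) :
    lap14 n x = ![n * (x 0 - x 1), n * (x 1 - x 0)] := by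
  ext i
  fin_cases i <;> simp [lap14, Matrix.mulVec, dotProduct, Fin.sum_univ_two] <;> ring

/-- The functional `[b] ↦ b 0 - b 1` on `ℤ^I/diag(ℤ)`. -/
def diffQ14 : Q14 →ₗ[ℤ] ℤ :=
  diag14.liftQ
    (LinearMap.proj (R := ℤ) (φ := fun _ : Fin 2 => ℤ) 0 - LinearMap.proj 1) fun b hb => by
      rw [LinearMap.mem_ker, LinearMap.sub_apply, LinearMap.proj_apply, LinearMap.proj_apply,
        (mem_diag14_iff b).mp hb, sub_self]

theorem diffQ14_mk (b : Fin 2 → ℤ) : diffQ14 (diag14.mkQ b) = b 0 - b 1 := rfl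

theorem diffQ14_injective : Function.Injective diffQ14 := by
  rw [injective_iff_map_eq_zero]
  intro q hq
  obtain ⟨b, rfl⟩ := diag14.mkQ_surjective q
  rw [diffQ14_mk, sub_eq_zero] at hq
  exact (Submodule.Quotient.mk_eq_zero _).mpr ((mem_diag14_iff b).mpr hq)

theorem diffQ14_surjective : Function.Surjective diffQ14 := fun z =>
  ⟨diag14.mkQ ![z, 0], by rw [diffQ14_mk]; simp⟩

/-- The functional `(a, [b]) ↦ a 0 - n (b 0 - b 1)`, which presents the cokernel as `ℤ`. -/
def cokerFunctional (n : ℕ) : ↥P14 →ₗ[ℤ] ℤ :=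
  (LinearMap.coprod (LinearMap.proj 0) (-(n : ℤ) • diffQ14)) ∘ₗ P14.subtype

theorem cokerFunctional_apply (n : ℕ) (p : ↥P14) :
    cokerFunctional n p = p.1.1 0 - n * diffQ14 p.1.2 := by
  simp [cokerFunctional, sub_eq_add_neg]

theorem cokerFunctional_j14 (n : ℕ) (q : Q14) :
    cokerFunctional n (j14 q) = -(n * diffQ14 q) := by
  rw [cokerFunctional_apply]
  exact zero_sub _

theorem cokerFunctional_surjective (n : ℕ) : Function.Surjective (cokerFunctional n) := fun z =>
  ⟨⟨(![z, -z], 0), Submodule.mem_prod.mpr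
    ⟨(mem_K14_iff _).mpr (by simp), Submodule.mem_top⟩⟩, by simp [cokerFunctional_apply]⟩

theorem comap_range_F14_eq_ker (n : ℕ) :
    Submodule.comap P14.subtype (LinearMap.range (F14 n)) =
      LinearMap.ker (cokerFunctional n) := by
  ext ⟨⟨a, q⟩, hp⟩
  rw [LinearMap.mem_ker, cokerFunctional_apply, Submodule.mem_comap, LinearMap.mem_range]
  constructor
  · rintro ⟨x, hx⟩
    obtain ⟨rfl, rfl⟩ := Prod.mk.inj hx
    simp [lap14_apply, diffQ14_mk, -Submodule.mkQ_apply]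
  · intro h
    obtain ⟨b, rfl⟩ := diag14.mkQ_surjective q
    have ha := (mem_K14_iff a).mp (Submodule.mem_prod.mp hp).1
    simp only [diffQ14_mk] at h
    refine ⟨b, Prod.ext ?_ rfl⟩
    change lap14 n b = a
    rw [lap14_apply]
    ext i
    fin_cases i
    · change (n : ℤ) * (b 0 - b 1) = a 0
      linarith
    · change (n : ℤ) * (b 1 - b 0) = a 1
      linarith

/-- The cokernel of `(Δ, θ^*)` is `ℤ`, and the composite
`ℤ^I/diag(ℤ) → coker ≅ ℤ` is injective with image `nℤ`. -/
theorem statement_14 (n : ℕ) (hn : 1 ≤ n) :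
    ∃ e : Coker14 n ≃ₗ[ℤ] ℤ,
      Function.Injective (fun q : Q14 =>
        e (Submodule.mkQ (Submodule.comap P14.subtype (LinearMap.range (F14 n))) (j14 q))) ∧
      LinearMap.range (e.toLinearMap ∘ₗ
          (Submodule.mkQ (Submodule.comap P14.subtype (LinearMap.range (F14 n)))) ∘ₗ j14) =
        Submodule.span ℤ {(n : ℤ)} := by
  let e : Coker14 n ≃ₗ[ℤ] ℤ :=
    (Submodule.quotEquivOfEq _ _ (comap_range_F14_eq_ker n)).trans
      ((cokerFunctional n).quotKerEquivOfSurjective (cokerFunctional_surjective n))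
  have he (q : Q14) :
      e (Submodule.mkQ (Submodule.comap P14.subtype (LinearMap.range (F14 n))) (j14 q)) =
        -(n * diffQ14 q) := cokerFunctional_j14 n q
  refine ⟨e, fun q r h => ?_, ?_⟩
  · simp only [he] at h
    have hn' : (n : ℤ) ≠ 0 := by positivity
    exact diffQ14_injective (mul_left_cancel₀ hn' (neg_injective h))
  · ext z
    rw [LinearMap.mem_range, Submodule.mem_span_singleton]
    constructor
    · rintro ⟨q, rfl⟩
      refine ⟨-diffQ14 q, ?_⟩
      change _ = e (Submodule.mkQ _ (j14 q))
      rw [he, smul_eq_mul]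
      ring
    · rintro ⟨c, rfl⟩
      obtain ⟨q, hq⟩ := diffQ14_surjective (-c)
      refine ⟨q, (he q).trans ?_⟩
      rw [hq, smul_eq_mul]
      ring
end
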